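/- Let a,b,c,α,β,γ be nonnegative integers such that the triple (a,b,c) is admissible. Then Δ(a,b,c,α,β,γ), a priori an element of the field ℚ(v), is in fact a Laurent polynomial, i.e. it lies in ℤ[v,v⁻¹]. -/

import Mathlib

/-!
Common definitions for formalizing "Colored Jones polynomials without tails"
(Lee--van der Veen).  We work in the field `RatFunc ℚ` of rational functions
in one variable `V` over `ℚ`.
-/

open Polynomial

noncomputable section

namespace CJP

/-- The variable `v` of the field `ℚ(v)`. -/
noncomputable def V : RatFunc ℚ := RatFunc.X

/-- The quantum integer `[k] = ∑_{j=0}^{k-1} v^(2(k-1)-4j)`, so that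
`(v^2 - v^(-2)) * [k] = v^(2k) - v^(-2k)`; it is `0` for `k ≤ 0`. -/
noncomputable def qint (k : ℤ) : RatFunc ℚ :=
  ∑ j ∈ Finset.range k.toNat, V ^ (2 * (k - 1) - 4 * (j : ℤ))

/-- The quantum factorial `[k]! = [1][2]⋯[k]` for `k ≥ 0`, and `0` for `k < 0`. -/
noncomputable def qfact (k : ℤ) : RatFunc ℚ :=
  if k < 0 then 0 else ∏ j ∈ Finset.range k.toNat, qint ((j : ℤ) + 1)

/-- `O^k = (-1)^k [k+1]`. -/
noncomputable def qO (k : ℤ) : RatFunc ℚ := (-1 : RatFunc ℚ) ^ k * qint (k + 1)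

/-- The two-part quantum multinomial (quantum binomial) `[n; k, n-k]`. -/
noncomputable def qbinom (n k : ℤ) : RatFunc ℚ := qfact n / (qfact k * qfact (n - k))

/-- `θ(a,b,c) = O^((a+b+c)/2) ⬝ [(a+b+c)/2; (-a+b+c)/2, (a-b+c)/2, (a+b-c)/2]`. -/
noncomputable def qtheta (a b c : ℤ) : RatFunc ℚ :=
  qO ((a + b + c) / 2) * (qfact ((a + b + c) / 2) /
    (qfact ((-a + b + c) / 2) * qfact ((a - b + c) / 2) * qfact ((a + b - c) / 2)))

/-- The normalized 6j-symbol
`Δ(a,b,c,α,β,γ) = ∑_z (O^z / O^((a+b+c)/2)) [z; (a+b+c)/2, z-(a+b+c)/2] ⋯`.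
Only finitely many `z` give a nonzero summand, so the `finsum` is well defined. -/
noncomputable def qdelta (a b c α β γ : ℤ) : RatFunc ℚ :=
  ∑ᶠ z : ℤ, (qO z / qO ((a + b + c) / 2)) * qbinom z ((a + b + c) / 2) *
    qbinom ((-a + b + c) / 2) (z - (a + β + γ) / 2) *
    qbinom ((a - b + c) / 2) (z - (α + b + γ) / 2) *
    qbinom ((a + b - c) / 2) (z - (α + β + c) / 2)

/-- The framing factor `f(a) = i^(-a) v^(-a(a+2)/2)`, written for even `a`
(where it equals `(-1)^(a/2) v^(-a(a+2)/2)`, an element of `ℤ[v,v⁻¹]`). -/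
noncomputable def qf (a : ℤ) : RatFunc ℚ :=
  (-1 : RatFunc ℚ) ^ (a / 2) * V ^ (-(a * (a + 2)) / 2)

/-- `f(a)^e = i^(-a e) v^(-a(a+2)e/2)` for `a*e` even, where it equals
`(-1)^(a e / 2) v^(-a(a+2)e/2)`. -/
noncomputable def qfpow (a e : ℤ) : RatFunc ℚ :=
  (-1 : RatFunc ℚ) ^ (a * e / 2) * V ^ (-(a * (a + 2) * e) / 2)

/-- `x ∈ ℚ(v)` is a Laurent polynomial with integer coefficients: for some `m`,
`x * v^m` is (the image in `ℚ(v)` of) a polynomial with integer coefficients. -/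
def IsIntLaurent (x : RatFunc ℚ) : Prop :=
  ∃ (p : Polynomial ℤ) (m : ℕ),
    x * V ^ m = algebraMap (Polynomial ℚ) (RatFunc ℚ) (p.map (Int.castRingHom ℚ))

/-- The leading coefficient of a rational function : the ratio of the leading
coefficients of its numerator and denominator. -/
noncomputable def leadC (x : RatFunc ℚ) : ℚ := x.num.leadingCoeff / x.denom.leadingCoeff

/-- Admissibility of a triple of nonnegative integers. -/
def Admissible (a b c : ℤ) : Prop := 2 ∣ (a + b + c) ∧ |a - b| ≤ c ∧ c ≤ a + b

/-- Membership of an integer lattice point in the polytope `nP`, where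
`P = {(a,b,c,d) ∈ [0,1]⁴ : |a-b| ≤ c ≤ a+b}`. -/
def inP (n a b c d : ℤ) : Prop :=
  0 ≤ a ∧ a ≤ n ∧ 0 ≤ b ∧ b ≤ n ∧ 0 ≤ c ∧ c ≤ n ∧ 0 ≤ d ∧ d ≤ n ∧
    |a - b| ≤ c ∧ c ≤ a + b

/-- The summand `T_{a,b,c,d}` of the state sum for the colored Jones polynomial
`J_{C(r,s,t,u),n+1}`. -/
noncomputable def T (r s t u n a b c d : ℤ) : RatFunc ℚ :=
  (qdelta (2*a) (2*b) (2*c) n n n) ^ 2 * qdelta (2*b) n n (2*d) n n *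
    qO (2*a) * qO (2*b) * qO (2*c) * qO (2*d) *
    qf (2*a) ^ r * qf (2*b) ^ s * qf (2*c) ^ t * qf (2*d) ^ (-u) *
    qtheta (2*a) (2*b) (2*c) /
    (qtheta (2*a) n n * qtheta (2*b) n n * qtheta (2*c) n n * qtheta (2*d) n n)

/-- The state sum `J(r,s,t,u; n+1)`, i.e. the `(n+1)`-colored Jones polynomial of the
`0`-framed Montesinos knot `C(r,s,t,u)`:
`f(n)^(-2(r-s+t-u)-2r-2s-2t+2u) ⬝ ∑_{(a,b,c,d) ∈ nP ∩ ℤ⁴} T_{a,b,c,d}`. -/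
noncomputable def J (r s t u n : ℤ) : RatFunc ℚ :=
  qfpow n (-2*(r - s + t - u) - 2*r - 2*s - 2*t + 2*u) *
    ∑ a ∈ Finset.Icc 0 n, ∑ b ∈ Finset.Icc 0 n, ∑ c ∈ Finset.Icc 0 n,
      ∑ d ∈ Finset.Icc 0 n,
        if |a - b| ≤ c ∧ c ≤ a + b then T r s t u n a b c d else 0

end CJP

namespace CJP

theorem V_ne_zero : V ≠ 0 := RatFunc.X_ne_zero

theorem V_pow_eq_algebraMap (m : ℕ) :
    V ^ m = algebraMap (Polynomial ℚ) (RatFunc ℚ)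
      ((X ^ m : Polynomial ℤ).map (Int.castRingHom ℚ)) := by
  simp [V, RatFunc.algebraMap_X]

theorem isIntLaurent_zero : IsIntLaurent 0 := ⟨0, 0, by simp⟩

theorem isIntLaurent_one : IsIntLaurent 1 := ⟨1, 0, by simp⟩

theorem IsIntLaurent.neg {x : RatFunc ℚ} (hx : IsIntLaurent x) : IsIntLaurent (-x) := by
  obtain ⟨p, m, hp⟩ := hx
  exact ⟨-p, m, by rw [neg_mul, hp]; simp⟩

theorem IsIntLaurent.add {x y : RatFunc ℚ} (hx : IsIntLaurent x) (hy : IsIntLaurent y) :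
    IsIntLaurent (x + y) := by
  obtain ⟨p, m, hp⟩ := hx
  obtain ⟨q, n, hq⟩ := hy
  refine ⟨p * X ^ n + q * X ^ m, m + n, ?_⟩
  simp only [Polynomial.map_add, Polynomial.map_mul, map_add, map_mul, ← V_pow_eq_algebraMap,
    ← hp, ← hq]
  ring

theorem IsIntLaurent.mul {x y : RatFunc ℚ} (hx : IsIntLaurent x) (hy : IsIntLaurent y) :
    IsIntLaurent (x * y) := by
  obtain ⟨p, m, hp⟩ := hx
  obtain ⟨q, n, hq⟩ := hy
  refine ⟨p * q, m + n, ?_⟩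
  simp only [Polynomial.map_mul, map_mul, ← hp, ← hq]
  ring

theorem isIntLaurent_V_zpow (k : ℤ) : IsIntLaurent (V ^ k) := by
  obtain ⟨n, rfl | rfl⟩ := k.eq_nat_or_neg
  · exact ⟨X ^ n, 0, by rw [pow_zero, mul_one, zpow_natCast, V_pow_eq_algebraMap]⟩
  · exact ⟨1, n, by simp [V_ne_zero]⟩

theorem isIntLaurent_neg_one_zpow (k : ℤ) : IsIntLaurent ((-1 : RatFunc ℚ) ^ k) := by
  obtain h | h := k.even_or_odd
  · rw [h.neg_one_zpow]
    exact isIntLaurent_one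
  · rw [h.neg_one_zpow]
    exact isIntLaurent_one.neg

theorem qint_add {x y : ℤ} (hx : 0 ≤ x) (hy : 0 ≤ y) :
    qint (x + y) = V ^ (2 * x) * qint y + V ^ (-2 * y) * qint x := by
  lift x to ℕ using hx
  lift y to ℕ using hy
  have h : ((x : ℤ) + y).toNat = y + x := by omega
  simp only [qint, h, Int.toNat_natCast, Finset.sum_range_add, Finset.mul_sum,
    ← zpow_add₀ V_ne_zero]
  congr 1 <;> refine Finset.sum_congr rfl fun j _ => ?_ <;> congr 1 <;> push_cast <;> ring

theorem qint_ne_zero {k : ℤ} (hk : 0 < k) : qint k ≠ 0 := by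
  lift k to ℕ using hk.le
  intro h
  have key : V ^ (2 * ((k : ℤ) - 1)) * qint k = algebraMap (Polynomial ℚ) (RatFunc ℚ)
      (∑ j ∈ Finset.range k, X ^ (4 * (k - 1 - j))) := by
    simp only [qint, Int.toNat_natCast, Finset.mul_sum, ← zpow_add₀ V_ne_zero, map_sum, map_pow,
      RatFunc.algebraMap_X]
    refine Finset.sum_congr rfl fun j hj => ?_
    rw [Finset.mem_range] at hj
    rw [← zpow_natCast, V]
    congr 1
    omega
  rw [h, mul_zero, eq_comm, map_eq_zero_iff _ (RatFunc.algebraMap_injective ℚ)] at key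
  have := congrArg (Polynomial.eval 1) key
  simp [Polynomial.eval_finsetSum] at this
  omega

theorem qfact_of_neg {k : ℤ} (hk : k < 0) : qfact k = 0 := if_pos hk

theorem qfact_zero : qfact 0 = 1 := by simp [qfact]

theorem qfact_add_one {k : ℤ} (hk : 0 ≤ k) : qfact (k + 1) = qfact k * qint (k + 1) := by
  lift k to ℕ using hk
  have h : ((k : ℤ) + 1).toNat = k + 1 := by omega
  rw [qfact, qfact, if_neg (by omega), if_neg (by omega), h, Int.toNat_natCast,
    Finset.prod_range_succ]

theorem qfact_ne_zero {k : ℤ} (hk : 0 ≤ k) : qfact k ≠ 0 := by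
  rw [qfact, if_neg hk.not_gt]
  exact Finset.prod_ne_zero_iff.2 fun j _ => qint_ne_zero (by omega)

theorem qbinom_eq_zero {n k : ℤ} (h : n < 0 ∨ k < 0 ∨ n < k) : qbinom n k = 0 := by
  obtain h | h | h := h
  · simp [qbinom, qfact_of_neg h]
  · simp [qbinom, qfact_of_neg h]
  · simp [qbinom, qfact_of_neg (sub_neg.2 h)]

theorem qbinom_zero_right {n : ℤ} (hn : 0 ≤ n) : qbinom n 0 = 1 := by
  simp [qbinom, qfact_zero, qfact_ne_zero hn]

theorem qbinom_self {n : ℤ} (hn : 0 ≤ n) : qbinom n n = 1 := by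
  simp [qbinom, qfact_zero, qfact_ne_zero hn]

/-- The quantum Pascal rule. -/
theorem qbinom_add_add_two {j m : ℤ} (hj : 0 ≤ j) (hm : 0 ≤ m) :
    qbinom (j + m + 1 + 1) (j + 1) =
      V ^ (2 * (j + 1)) * qbinom (j + m + 1) (j + 1) +
        V ^ (-2 * (m + 1)) * qbinom (j + m + 1) j := by
  have h₁ : j + m + 1 + 1 - (j + 1) = m + 1 := by ring
  have h₂ : j + m + 1 - (j + 1) = m := by ring
  have h₃ : j + m + 1 - j = m + 1 := by ring
  have h₄ : j + m + 1 + 1 = (j + 1) + (m + 1) := by ring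
  have hadd := qint_add (x := j + 1) (y := m + 1) (by omega) (by omega)
  have hj₀ := qfact_ne_zero hj
  have hm₀ := qfact_ne_zero hm
  have hj₁ := qint_ne_zero (k := j + 1) (by omega)
  have hm₁ := qint_ne_zero (k := m + 1) (by omega)
  rw [qbinom, qbinom, qbinom, h₁, h₂, h₃, qfact_add_one (k := j + m + 1) (by omega),
    qfact_add_one hj, qfact_add_one hm, h₄, hadd]
  generalize V ^ (2 * (j + 1)) = s
  generalize V ^ (-2 * (m + 1)) = t
  field_simp

theorem isIntLaurent_qbinom (n k : ℤ) : IsIntLaurent (qbinom n k) := by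
  by_cases hn : n < 0
  · rw [qbinom_eq_zero (.inl hn)]
    exact isIntLaurent_zero
  lift n to ℕ using not_lt.1 hn
  clear hn
  induction n generalizing k with
  | zero =>
    obtain h | rfl | h := lt_trichotomy k 0
    · rw [qbinom_eq_zero (.inr (.inl h))]
      exact isIntLaurent_zero
    · rw [qbinom_zero_right (by simp)]
      exact isIntLaurent_one
    · rw [qbinom_eq_zero (.inr (.inr (by simpa using h)))]
      exact isIntLaurent_zero
  | succ n ih =>
    by_cases h : k < 0 ∨ ((n + 1 : ℕ) : ℤ) < k
    · rw [qbinom_eq_zero (.inr h)]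
      exact isIntLaurent_zero
    push Not at h
    obtain rfl | h₀ := h.1.eq_or_lt
    · rw [qbinom_zero_right (by positivity)]
      exact isIntLaurent_one
    obtain rfl | h₁ := h.2.eq_or_lt
    · rw [qbinom_self (by positivity)]
      exact isIntLaurent_one
    obtain ⟨j, rfl⟩ : ∃ j, k = j + 1 := ⟨k - 1, by ring⟩
    obtain ⟨m, hm⟩ : ∃ m, (n : ℤ) = j + m + 1 := ⟨n - j - 1, by ring⟩
    have pascal := qbinom_add_add_two (j := j) (m := m) (by omega) (by omega)
    rw [← hm] at pascal
    rw [Nat.cast_succ, pascal]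
    exact ((isIntLaurent_V_zpow _).mul (ih _)).add ((isIntLaurent_V_zpow _).mul (ih _))

/-- Absorbing the factor `[z+1]/[s+1]` into a quantum binomial. -/
theorem qO_div_mul_qbinom {z s : ℤ} (hs : 0 ≤ s) :
    qO z / qO s * qbinom z s = (-1) ^ (z - s) * qbinom (z + 1) (s + 1) := by
  by_cases h : z < s
  · rw [qbinom_eq_zero (.inr (.inr h)), qbinom_eq_zero (.inr (.inr (by omega)))]
    simp
  have hz : 0 ≤ z := by omega
  have hd : z + 1 - (s + 1) = z - s := by ring
  have h₁ := qint_ne_zero (k := s + 1) (by omega)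
  have h₂ := qfact_ne_zero hs
  have h₃ := qfact_ne_zero (k := z - s) (by omega)
  rw [qO, qO, qbinom, qbinom, hd, qfact_add_one hz, qfact_add_one hs,
    zpow_sub₀ (neg_ne_zero.2 one_ne_zero)]
  have h₄ : (-1 : RatFunc ℚ) ^ s ≠ 0 := zpow_ne_zero _ (neg_ne_zero.2 one_ne_zero)
  generalize (-1 : RatFunc ℚ) ^ s = u at *
  generalize (-1 : RatFunc ℚ) ^ z = w
  field_simp

end CJP

open CJP in
/-- For nonnegative integers `a,b,c,α,β,γ` with `(a,b,c)`
admissible, `Δ(a,b,c,α,β,γ)` is a Laurent polynomial, i.e. lies in `ℤ[v,v⁻¹]`. -/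
theorem delta_is_laurent (a b c α β γ : ℤ) (ha : 0 ≤ a) (hb : 0 ≤ b) (hc : 0 ≤ c)
    (hα : 0 ≤ α) (hβ : 0 ≤ β) (hγ : 0 ≤ γ) (hadm : Admissible a b c) :
    IsIntLaurent (qdelta a b c α β γ) := by
  refine finsum_induction IsIntLaurent isIntLaurent_zero (fun _ _ => IsIntLaurent.add) fun z => ?_
  rw [qO_div_mul_qbinom (by omega)]
  exact ((((isIntLaurent_neg_one_zpow _).mul (isIntLaurent_qbinom _ _)).mul
    (isIntLaurent_qbinom _ _)).mul (isIntLaurent_qbinom _ _)).mul (isIntLaurent_qbinom _ _)
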